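/- arXiv:1804.03752 — 2 statements merged into one kernel-verified Lean document; each statement's English description precedes it below -/
import Mathlib

section
/- For any graph G with at least one edge, n/(n − μ) ≤ ω(G), where μ is the spectral radius of the adjacency matrix, n the number of vertices, and ω(G) the clique number (Wilf's bound). -/
open Finset in
theorem motzkin_straus_aux {V : Type*} [Fintype V] [DecidableEq V] (G : SimpleGraph V)
    [DecidableRel G.Adj] (k : ℕ) : ∀ (y : V → ℝ), (∀ i, 0 ≤ y i) →
    (univ.filter (fun i => y i ≠ 0)).card = k →
    (G.cliqueNum : ℝ) * (y ⬝ᵥ (G.adjMatrix ℝ).mulVec y) ≤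
      ((G.cliqueNum : ℝ) - 1) * (∑ i, y i) ^ 2 := by
  induction k using Nat.strong_induction_on with
  | _ k ih =>
  intro y hy hk
  by_cases hc : G.IsClique (univ.filter (fun i => y i ≠ 0) : Finset V)
  · have hcard := hc.card_le_cliqueNum
    set S := univ.filter (fun i => y i ≠ 0) with hS
    have hQ : y ⬝ᵥ (G.adjMatrix ℝ).mulVec y ≤ (∑ i, y i) ^ 2 - ∑ i, y i ^ 2 := by
      have h1 : (∑ i, y i) ^ 2 - ∑ i, y i ^ 2
          = ∑ i, ∑ j, (y i * y j - if i = j then y i * y j else 0) := by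
        simp only [sum_sub_distrib]
        rw [sq, sum_mul_sum]
        simp [sq]
      rw [h1]
      simp only [dotProduct, Matrix.mulVec, mul_sum]
      refine sum_le_sum fun i _ => sum_le_sum fun j _ => ?_
      have := mul_nonneg (hy i) (hy j)
      rw [SimpleGraph.adjMatrix_apply]
      by_cases hij : i = j
      · subst hij; simp
      · by_cases ha : G.Adj i j <;> simp [hij, ha, this]
    have hs : ∑ i, y i = ∑ i ∈ S, y i := by
      rw [hS, sum_filter_ne_zero]
    have hle : ∑ i ∈ S, y i ^ 2 ≤ ∑ i, y i ^ 2 :=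
      sum_le_sum_of_subset_of_nonneg (subset_univ _) (fun i _ _ => sq_nonneg _)
    have hcs : (∑ i ∈ S, y i) ^ 2 ≤ S.card * ∑ i ∈ S, y i ^ 2 := sq_sum_le_card_mul_sum_sq
    have hq0 : 0 ≤ ∑ i ∈ S, y i ^ 2 := sum_nonneg fun i _ => sq_nonneg _
    have hcard' : (S.card : ℝ) ≤ G.cliqueNum := by exact_mod_cast hcard
    have h0 : (0:ℝ) ≤ G.cliqueNum := Nat.cast_nonneg _
    have a1 := mul_le_mul_of_nonneg_left hQ h0
    have a2 := mul_le_mul_of_nonneg_left hle h0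
    have a3 := mul_le_mul_of_nonneg_right hcard' hq0
    rw [← hs] at hcs
    linarith
  · have hex : ∃ u v, y u ≠ 0 ∧ y v ≠ 0 ∧ u ≠ v ∧ ¬ G.Adj u v ∧
        (G.adjMatrix ℝ).mulVec y v ≤ (G.adjMatrix ℝ).mulVec y u := by
      simp only [SimpleGraph.IsClique, Set.Pairwise] at hc
      push Not at hc
      obtain ⟨u, hu, v, hv, huv, ha⟩ := hc
      simp at hu hv
      rcases le_total ((G.adjMatrix ℝ).mulVec y v) ((G.adjMatrix ℝ).mulVec y u) with h | h
      · exact ⟨u, v, hu, hv, huv, ha, h⟩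
      · exact ⟨v, u, hv, hu, huv.symm, fun h => ha h.symm, h⟩
    obtain ⟨u, v, hu, hv, huv, ha, hle⟩ := hex
    have ha' : ¬ G.Adj v u := fun h => ha h.symm
    set d : V → ℝ := Pi.single u 1 - Pi.single v 1 with hd
    set z : V → ℝ := y + y v • d with hz
    have hzv : z v = 0 := by simp [hz, hd, huv.symm]
    have hzu : z u = y u + y v := by simp [hz, hd, huv]
    have hzo : ∀ i, i ≠ u → i ≠ v → z i = y i := fun i h1 h2 => by simp [hz, hd, h1, h2]
    have hz0 : ∀ i, 0 ≤ z i := by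
      intro i
      by_cases h1 : i = u
      · subst h1; rw [hzu]; exact add_nonneg (hy _) (hy _)
      by_cases h2 : i = v
      · subst h2; rw [hzv]
      rw [hzo i h1 h2]; exact hy i
    have hlt : (univ.filter (fun i => z i ≠ 0)).card < k := by
      rw [← hk]
      apply card_lt_card
      rw [ssubset_iff_of_subset]
      · exact ⟨v, by simp [hv], by simp [hzv]⟩
      · intro i hi
        simp only [mem_filter, mem_univ, true_and] at hi ⊢
        by_cases h1 : i = u
        · subst h1; exact hu
        by_cases h2 : i = v
        · subst h2; exact hv
        rwa [hzo i h1 h2] at hi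
    have hI := ih _ hlt z hz0 rfl
    have hsum : ∑ i, z i = ∑ i, y i := by
      simp [hz, hd, sum_add_distrib, ← mul_sum]
    have hdd : d ⬝ᵥ (G.adjMatrix ℝ).mulVec d = 0 := by
      simp [hd, Matrix.mulVec_sub, sub_dotProduct, ha, ha']
    have hdy : d ⬝ᵥ (G.adjMatrix ℝ).mulVec y
        = (G.adjMatrix ℝ).mulVec y u - (G.adjMatrix ℝ).mulVec y v := by
      rw [hd, sub_dotProduct, single_dotProduct, single_dotProduct, one_mul, one_mul]
    have hyd : y ⬝ᵥ (G.adjMatrix ℝ).mulVec d = d ⬝ᵥ (G.adjMatrix ℝ).mulVec y := by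
      rw [Matrix.dotProduct_mulVec, ← Matrix.mulVec_transpose, SimpleGraph.transpose_adjMatrix,
        dotProduct_comm]
    have hQ : z ⬝ᵥ (G.adjMatrix ℝ).mulVec z = y ⬝ᵥ (G.adjMatrix ℝ).mulVec y +
        2 * y v * (d ⬝ᵥ (G.adjMatrix ℝ).mulVec y) := by
      rw [hz, Matrix.mulVec_add, Matrix.mulVec_smul, add_dotProduct, dotProduct_add,
        dotProduct_add, smul_dotProduct, smul_dotProduct, dotProduct_smul, dotProduct_smul,
        hyd, hdd]
      simp only [smul_eq_mul]
      ring
    have hp : 0 ≤ 2 * y v * (d ⬝ᵥ (G.adjMatrix ℝ).mulVec y) := by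
      rw [hdy]
      exact mul_nonneg (mul_nonneg zero_le_two (hy v)) (sub_nonneg.2 hle)
    rw [hsum, hQ] at hI
    have h0 : (0:ℝ) ≤ G.cliqueNum := Nat.cast_nonneg _
    have := mul_nonneg h0 hp
    linarith

theorem wilf_bound
    {V : Type*} [Fintype V] [DecidableEq V] (G : SimpleGraph V)
    [DecidableRel G.Adj]
    (hA : (G.adjMatrix ℝ).IsHermitian)
    (hedge : G.edgeFinset.Nonempty)
    (μ : ℝ) (hub : ∀ i, hA.eigenvalues i ≤ μ) (hmem : ∃ i, hA.eigenvalues i = μ) :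
    (Fintype.card V : ℝ) / ((Fintype.card V : ℝ) - μ) ≤ (G.cliqueNum : ℝ) := by
  obtain ⟨i, rfl⟩ := hmem
  set m := hA.eigenvalues i with hm
  obtain ⟨x, hx0, hx⟩ : ∃ x : V → ℝ, x ≠ 0 ∧ (G.adjMatrix ℝ).mulVec x = m • x := by
    refine ⟨hA.eigenvectorBasis i, ?_, hA.mulVec_eigenvectorBasis i⟩
    intro h
    apply hA.eigenvectorBasis.orthonormal.ne_zero i
    ext j
    exact congrFun h j
  have hq : 0 < ∑ j, x j ^ 2 := by
    obtain ⟨j, hj⟩ := Function.ne_iff.1 hx0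
    exact Finset.sum_pos' (fun _ _ => sq_nonneg _) ⟨j, Finset.mem_univ _, by
      have : x j ≠ 0 := hj
      positivity⟩
  have h1 := motzkin_straus_aux G _ (fun j => |x j|) (fun _ => abs_nonneg _) rfl
  have h2 : m * ∑ j, x j ^ 2 ≤
      (fun j => |x j|) ⬝ᵥ (G.adjMatrix ℝ).mulVec (fun j => |x j|) := by
    have : m * ∑ j, x j ^ 2 = x ⬝ᵥ (G.adjMatrix ℝ).mulVec x := by
      rw [hx, dotProduct_smul]
      simp [dotProduct, sq]
    rw [this]
    simp only [dotProduct, Matrix.mulVec, Finset.mul_sum]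
    refine Finset.sum_le_sum fun a _ => Finset.sum_le_sum fun b _ => ?_
    rw [SimpleGraph.adjMatrix_apply]
    have := le_abs_self (x a * x b)
    rw [abs_mul] at this
    split_ifs <;> simp [this]
  have h3 : (∑ j, |x j|) ^ 2 ≤ Fintype.card V * ∑ j, x j ^ 2 := by
    have := sq_sum_le_card_mul_sum_sq (s := Finset.univ) (f := fun j => |x j|)
    simpa using this
  have hn : (0:ℝ) < Fintype.card V := by
    exact_mod_cast Fintype.card_pos_iff.2 ⟨i⟩
  have hw : (1:ℝ) ≤ G.cliqueNum := by
    have : G.IsClique (({i} : Finset V) : Set V) := by simp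
    have := this.card_le_cliqueNum
    exact_mod_cast (by simpa using this)
  have h4 : (G.cliqueNum : ℝ) * m ≤ ((G.cliqueNum : ℝ) - 1) * Fintype.card V := by
    refine le_of_mul_le_mul_right ?_ hq
    have a := mul_le_mul_of_nonneg_left h2 (zero_le_one.trans hw)
    have b := mul_le_mul_of_nonneg_left h3 (sub_nonneg.2 hw)
    linarith
  have hpos : 0 < (Fintype.card V : ℝ) - m := by
    by_contra h
    have := mul_le_mul_of_nonneg_left (not_lt.1 h) (zero_le_one.trans hw)
    linarith
  rw [div_le_iff₀ hpos]
  linarith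
end

section
/- For any graph G on n vertices with degree sequence d₁, ..., dₙ, the Caro–Wei bound holds: Σᵢ 1/(n − dᵢ) ≤ ω(G). -/
lemma caro_wei_aux {V : Type*} [Fintype V] [DecidableEq V] (G : SimpleGraph V)
    [DecidableRel G.Adj] (S : Finset V) :
    ∃ T : Finset V, T ⊆ S ∧ G.IsClique (T : Set V) ∧
      (∑ v ∈ S, (1 : ℝ) / ((S.filter (fun u => ¬ G.Adj v u)).card : ℝ)) ≤ (T.card : ℝ) := by
  induction S using Finset.strongInduction with
  | H S ih =>
    rcases S.eq_empty_or_nonempty with rfl | hS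
    · exact ⟨∅, by simp⟩
    obtain ⟨v, hv, hmin⟩ :=
      Finset.exists_min_image S (fun v => (S.filter (fun u => ¬ G.Adj v u)).card) hS
    have hpos : ∀ w, ∀ R : Finset V, w ∈ R → 0 < (R.filter (fun u => ¬ G.Adj w u)).card := by
      intro w R hw
      exact Finset.card_pos.mpr ⟨w, by simp [hw]⟩
    have hss : S.filter (fun u => G.Adj v u) ⊂ S :=
      Finset.filter_ssubset.mpr ⟨v, hv, by simp⟩
    obtain ⟨T, hTS, hT, hsum⟩ := ih _ hss
    have hvT : v ∉ T := fun h => by simpa using hTS h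
    refine ⟨insert v T, ?_, ?_, ?_⟩
    · exact Finset.insert_subset hv (hTS.trans hss.1)
    · rw [Finset.coe_insert]
      refine hT.insert ?_
      intro b hb _
      exact (Finset.mem_filter.mp (hTS hb)).2
    · rw [Finset.card_insert_of_notMem hvT, ← Finset.sum_filter_add_sum_filter_not S (fun u => G.Adj v u)]
      push_cast
      refine add_le_add (le_trans (Finset.sum_le_sum ?_) hsum) ?_
      · intro w hw
        apply one_div_le_one_div_of_le
        · exact_mod_cast hpos w _ hw
        · exact_mod_cast Finset.card_le_card (Finset.filter_subset_filter _ hss.1)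
      · have hp : (0 : ℝ) < ((S.filter (fun u => ¬ G.Adj v u)).card : ℝ) := by
          exact_mod_cast hpos v S hv
        calc _ ≤ ∑ w ∈ S.filter (fun u => ¬ G.Adj v u),
              (1 : ℝ) / ((S.filter (fun u => ¬ G.Adj v u)).card : ℝ) := by
              refine Finset.sum_le_sum fun w hw => ?_
              apply one_div_le_one_div_of_le hp
              exact_mod_cast hmin w (Finset.mem_filter.mp hw).1
          _ = 1 := by
              rw [Finset.sum_const, nsmul_eq_mul, mul_one_div_cancel hp.ne']

theorem caro_wei_complement_form
    {V : Type*} [Fintype V] [DecidableEq V] [Nonempty V] (G : SimpleGraph V)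
    [DecidableRel G.Adj] :
    (∑ v, (1 : ℝ) / ((Fintype.card V : ℝ) - (G.degree v : ℝ))) ≤
      (G.cliqueNum : ℝ) := by
  obtain ⟨T, -, hT, hsum⟩ := caro_wei_aux G Finset.univ
  have h1 : (T.card : ℝ) ≤ G.cliqueNum := by
    exact_mod_cast SimpleGraph.IsClique.card_le_cliqueNum (tc := hT)
  refine le_trans (le_of_eq (Finset.sum_congr rfl fun v _ => ?_)) (hsum.trans h1)
  have h := Finset.card_filter_add_card_filter_not (s := (Finset.univ : Finset V)) (fun u => G.Adj v u)
  rw [← SimpleGraph.neighborFinset_eq_filter, SimpleGraph.card_neighborFinset_eq_degree,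
    Finset.card_univ] at h
  rw [← h]
  push_cast
  ring
end
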